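/- The Drinfeld–Kohno Lie algebra 𝔤_3 decomposes as a vector space into the direct sum of the free Lie subalgebra 𝔦_3 generated by t_{13} and t_{23}, and the one-dimensional subalgebra spanned by t_{12}; moreover 𝔦_3 is an ideal and the center of 𝔤_3 is spanned by t_{12} + t_{13} + t_{23}. -/

import Mathlib

noncomputable section
open FreeLieAlgebra

def DKrels (n : ℕ) : Set (FreeLieAlgebra ℚ (Fin n × Fin n)) :=
  {x | (∃ i, x = of ℚ (i, i)) ∨
       (∃ i j, x = of ℚ (i, j) - of ℚ (j, i)) ∨
       (∃ i j k, i ≠ j ∧ i ≠ k ∧ j ≠ k ∧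
          x = ⁅of ℚ (i, j) + of ℚ (i, k), of ℚ (j, k)⁆) ∨
       (∃ i j k l, ({i, j} ∩ {k, l} : Set (Fin n)) = ∅ ∧ i ≠ j ∧ k ≠ l ∧
          x = ⁅of ℚ (i, j), of ℚ (k, l)⁆)}

def DKideal (n : ℕ) : LieIdeal ℚ (FreeLieAlgebra ℚ (Fin n × Fin n)) :=
  LieSubmodule.lieSpan ℚ _ (DKrels n)

/-- The Drinfeld–Kohno Lie algebra on `n` strands over `ℚ`. -/
def DK (n : ℕ) : Type := FreeLieAlgebra ℚ (Fin n × Fin n) ⧸ DKideal n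

instance (n : ℕ) : LieRing (DK n) := by unfold DK; infer_instance
instance (n : ℕ) : LieAlgebra ℚ (DK n) := by unfold DK; infer_instance

/-- The generator `t_{ij}` of the Drinfeld–Kohno Lie algebra. -/
def tDK {n : ℕ} (i j : Fin n) : DK n :=
  LieSubmodule.Quotient.mk' (DKideal n) (of ℚ (i, j))

namespace FreeLieAlgebra

variable {R X : Type*} [CommRing R]

attribute [local instance] LieRing.ofAssociativeRing

theorem lieSpan_range_of : LieSubalgebra.lieSpan R _ (Set.range (of R : X → _)) = ⊤ := by
  set S := LieSubalgebra.lieSpan R _ (Set.range (of R : X → _))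
  let g : FreeLieAlgebra R X →ₗ⁅R⁆ S :=
    lift R fun x => ⟨of R x, LieSubalgebra.subset_lieSpan ⟨x, rfl⟩⟩
  have h : S.incl.comp g = LieHom.id := by ext x; simp [g]
  refine eq_top_iff.2 fun u _ => ?_
  have hu : (g u : FreeLieAlgebra R X) = u := congr($h u)
  exact hu ▸ (g u).2

theorem induction {p : FreeLieAlgebra R X → Prop} (of : ∀ x, p (of R x))
    (zero : p 0) (add : ∀ u v, p u → p v → p (u + v)) (smul : ∀ (a : R) u, p u → p (a • u))
    (lie : ∀ u v, p u → p v → p ⁅u, v⁆) (u : FreeLieAlgebra R X) : p u := by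
  have hu : u ∈ LieSubalgebra.lieSpan R _ (Set.range (FreeLieAlgebra.of R : X → _)) := by
    simp [lieSpan_range_of]
  induction hu using LieSubalgebra.lieSpan_induction with
  | mem _ h => obtain ⟨x, rfl⟩ := h; exact of x
  | zero => exact zero
  | add u v _ _ hu hv => exact add u v hu hv
  | smul a u _ hu => exact smul a u hu
  | lie u v _ _ hu hv => exact lie u v hu hv

section Derivation

variable {M : Type*} [AddCommGroup M] [Module R M]
  (ρ : FreeLieAlgebra R X →ₗ⁅R⁆ Module.End R M) (f : X → M)

/-- The extension of the trivial representation by `ρ` whose cocycle takes the values `f` on the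
generators. -/
def extendRep : FreeLieAlgebra R X →ₗ⁅R⁆ Module.End R (M × R) :=
  lift R fun x => LinearMap.inl R M R ∘ₗ (ρ (of R x)).coprod (LinearMap.toSpanSingleton R M (f x))

/-- The derivation of the free Lie algebra into the representation `ρ` which takes the values `f`
on the generators. -/
def derivationOf : FreeLieAlgebra R X →ₗ[R] M where
  toFun u := (extendRep ρ f u (0, 1)).1
  map_add' := by simp
  map_smul' := by simp

theorem derivationOf_of (x : X) : derivationOf ρ f (of R x) = f x := by
  simp [derivationOf, extendRep]

theorem extendRep_apply (u : FreeLieAlgebra R X) (m : M) (c : R) :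
    extendRep ρ f u (m, c) = (ρ u m + c • derivationOf ρ f u, 0) := by
  suffices h : ∃ d : M, ∀ m c, extendRep ρ f u (m, c) = (ρ u m + c • d, 0) by
    obtain ⟨d, hd⟩ := h
    simp [derivationOf, hd]
  induction u using FreeLieAlgebra.induction with
  | of x => exact ⟨f x, fun m c => by simp [extendRep]⟩
  | zero => exact ⟨0, fun m c => by simp [Prod.zero_eq_mk]⟩
  | add u v hu hv =>
    obtain ⟨d, hd⟩ := hu
    obtain ⟨e, he⟩ := hv
    refine ⟨d + e, fun m c => ?_⟩
    simp only [map_add, LinearMap.add_apply, hd, he, Prod.mk_add_mk, add_zero, smul_add]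
    congr 1; abel
  | smul a u hu =>
    obtain ⟨d, hd⟩ := hu
    exact ⟨a • d, fun m c => by simp [hd, smul_comm a c]⟩
  | lie u v hu hv =>
    obtain ⟨d, hd⟩ := hu
    obtain ⟨e, he⟩ := hv
    refine ⟨ρ u e - ρ v d, fun m c => ?_⟩
    simp [LieRing.of_associative_ring_bracket, hd, he, smul_sub]
    abel

theorem derivationOf_lie (u v : FreeLieAlgebra R X) :
    derivationOf ρ f ⁅u, v⁆ = ρ u (derivationOf ρ f v) - ρ v (derivationOf ρ f u) := by
  have h := extendRep_apply ρ f ⁅u, v⁆ 0 1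
  simpa [LieRing.of_associative_ring_bracket, extendRep_apply] using congr(($h).1).symm

end Derivation

section Center

variable {X : Type*}

/-- The derivation multiplying each homogeneous element by its degree. -/
def degree : FreeLieAlgebra ℚ X →ₗ[ℚ] FreeLieAlgebra ℚ X :=
  derivationOf (LieAlgebra.ad ℚ _) (of ℚ)

theorem degree_lie (u v : FreeLieAlgebra ℚ X) :
    degree ⁅u, v⁆ = ⁅degree u, v⁆ + ⁅u, degree v⁆ := by
  rw [degree, derivationOf_lie, LieAlgebra.ad_apply, LieAlgebra.ad_apply, ← lie_skew v]
  abel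

theorem iSup_eigenspace_degree :
    ⨆ n : ℕ, Module.End.eigenspace (degree (X := X)) (n + 1 : ℚ) = ⊤ := by
  set S := ⨆ n : ℕ, Module.End.eigenspace (degree (X := X)) (n + 1 : ℚ)
  refine eq_top_iff.2 fun u _ => ?_
  induction u using FreeLieAlgebra.induction with
  | of x =>
    refine Submodule.mem_iSup_of_mem 0 ?_
    simp [degree, derivationOf_of]
  | zero => exact zero_mem _
  | add u v hu hv => exact add_mem (hu trivial) (hv trivial)
  | smul a u hu => exact S.smul_mem a (hu trivial)
  | lie u v hu hv =>
    refine Submodule.iSup_induction _ (motive := fun u => ⁅u, v⁆ ∈ S) (hu trivial) ?_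
      (by simp) (fun a b ha hb => by rw [add_lie]; exact add_mem ha hb)
    intro n u hu
    refine Submodule.iSup_induction _ (motive := fun v => ⁅u, v⁆ ∈ S) (hv trivial) ?_
      (by simp) (fun a b ha hb => by rw [lie_add]; exact add_mem ha hb)
    intro m v hv
    refine Submodule.mem_iSup_of_mem (n + m + 1) ?_
    rw [Module.End.mem_eigenspace_iff] at hu hv ⊢
    rw [degree_lie, hu, hv, smul_lie, lie_smul, ← add_smul]
    congr 1
    push_cast
    ring

theorem eq_zero_of_degree_eq_zero {u : FreeLieAlgebra ℚ X} (hu : degree u = 0) : u = 0 := by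
  have h := (Module.End.eigenspaces_iSupIndep (degree (X := X))) 0
  have hle : ⨆ n : ℕ, Module.End.eigenspace (degree (X := X)) (n + 1 : ℚ) ≤
      ⨆ (μ : ℚ) (_ : μ ≠ 0), Module.End.eigenspace (degree (X := X)) μ :=
    iSup_le fun n => le_iSup₂_of_le (n + 1 : ℚ) (by positivity) le_rfl
  rw [iSup_eigenspace_degree, top_le_iff] at hle
  rw [hle, disjoint_top] at h
  have : u ∈ Module.End.eigenspace (degree (X := X)) 0 := by
    simp [hu]
  simpa [h] using this

/-- The action on the free associative algebra by left multiplication. -/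
def leftRep (R X : Type*) [CommRing R] :
    FreeLieAlgebra R X →ₗ⁅R⁆ Module.End R (FreeAlgebra R X) :=
  lift R fun x => LinearMap.mulLeft R (FreeAlgebra.ι R x)

theorem leftRep_intertwines {R X M : Type*} [CommRing R] [AddCommGroup M] [Module R M]
    (ψ : FreeLieAlgebra R X →ₗ⁅R⁆ Module.End R M) (u : FreeLieAlgebra R X)
    (a : FreeAlgebra R X) :
    FreeAlgebra.lift R (fun x => ψ (of R x)) (leftRep R X u a) =
      ψ u * FreeAlgebra.lift R (fun x => ψ (of R x)) a := by
  induction u using FreeLieAlgebra.induction generalizing a with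
  | of x => simp [leftRep]
  | zero => simp
  | add u v hu hv => simp [hu, hv, add_mul]
  | smul c u hu => simp [hu]
  | lie u v hu hv => simp [LieRing.of_associative_ring_bracket, hu, hv, sub_mul, mul_assoc]

theorem eq_zero_of_leftRep_one_eq_zero {u : FreeLieAlgebra ℚ X} (hu : leftRep ℚ X u 1 = 0) :
    u = 0 := by
  apply eq_zero_of_degree_eq_zero
  have h := leftRep_intertwines (extendRep (LieAlgebra.ad ℚ _) (of ℚ)) u 1
  rw [hu, map_zero, map_one, mul_one] at h
  simp [degree, derivationOf, ← h]

theorem eq_zero_of_forall_lie_eq_zero [Nontrivial X] {z : FreeLieAlgebra ℚ X}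
    (hz : ∀ u : FreeLieAlgebra ℚ X, ⁅u, z⁆ = 0) : z = 0 := by
  classical
  obtain ⟨x, y, hxy⟩ := exists_pair_ne X
  apply eq_zero_of_leftRep_one_eq_zero
  set d := derivationOf (leftRep ℚ X) (Pi.single y 1) with hd
  have hl (a : X) (b) : leftRep ℚ X (of ℚ a) b = FreeAlgebra.ι ℚ a * b := by simp [leftRep]
  have hx : d ⁅of ℚ x, z⁆ = _ := derivationOf_lie _ _ _ _
  have hy : d ⁅of ℚ y, z⁆ = _ := derivationOf_lie _ _ _ _
  rw [hz, map_zero, derivationOf_of, ← hd, hl] at hx hy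
  have hdz : d z = 0 := by simpa [hxy] using hx
  simpa [hdz] using hy

end Center

end FreeLieAlgebra

namespace DK

variable {n : ℕ} {L : Type*} [LieRing L] [LieAlgebra ℚ L]

/-- The quotient map onto the Drinfeld–Kohno Lie algebra. -/
def proj (n : ℕ) : FreeLieAlgebra ℚ (Fin n × Fin n) →ₗ⁅ℚ⁆ DK n where
  toFun u := LieSubmodule.Quotient.mk' (DKideal n) u
  map_add' _ _ := rfl
  map_smul' _ _ := rfl
  map_lie' := rfl

theorem proj_surjective : Function.Surjective (proj n) :=
  LieSubmodule.Quotient.surjective_mk' (DKideal n)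

theorem proj_eq_zero {u : FreeLieAlgebra ℚ (Fin n × Fin n)} : proj n u = 0 ↔ u ∈ DKideal n :=
  LieSubmodule.Quotient.mk_eq_zero (N := DKideal n)

theorem proj_of (i j : Fin n) : proj n (of ℚ (i, j)) = tDK i j := rfl

theorem exists_lieHom (f : Fin n × Fin n → L) (hf : ∀ r ∈ DKrels n, lift ℚ f r = 0) :
    ∃ F : DK n →ₗ⁅ℚ⁆ L, ∀ i j, F (tDK i j) = f (i, j) := by
  have hle : DKideal n ≤ (lift ℚ f).ker :=
    LieSubmodule.lieSpan_le.2 fun r hr => LieHom.mem_ker.2 (hf r hr)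
  have hwd (u v) (h : proj n u = proj n v) : lift ℚ f u = lift ℚ f v := by
    rw [← sub_eq_zero, ← map_sub, ← LieHom.mem_ker]
    exact hle (proj_eq_zero.1 (by rw [map_sub, h, sub_self]))
  let s := Function.surjInv (proj_surjective (n := n))
  have hs (u) : proj n (s u) = u := Function.surjInv_eq _ u
  refine ⟨{ toFun := fun u => lift ℚ f (s u), map_add' := ?_, map_smul' := ?_, map_lie' := ?_ }, ?_⟩
  · intro u v; rw [← map_add]; apply hwd; simp [hs]
  · intro a u; rw [RingHom.id_apply, ← map_smul]; apply hwd; simp [hs]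
  · intro u v; rw [← LieHom.map_lie]; apply hwd; simp [hs]
  · intro i j
    rw [← lift_of_apply (R := ℚ) f]
    exact hwd _ _ (by rw [hs, proj_of])

theorem t_self (i : Fin n) : (tDK i i : DK n) = 0 :=
  proj_eq_zero.2 (LieSubmodule.subset_lieSpan (Or.inl ⟨i, rfl⟩))

theorem t_symm (i j : Fin n) : (tDK i j : DK n) = tDK j i := by
  rw [← sub_eq_zero, ← proj_of, ← proj_of, ← map_sub]
  exact proj_eq_zero.2 (LieSubmodule.subset_lieSpan (Or.inr (Or.inl ⟨i, j, rfl⟩)))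

theorem lie_add_t {i j k : Fin n} (hij : i ≠ j) (hik : i ≠ k) (hjk : j ≠ k) :
    ⁅(tDK i j : DK n) + tDK i k, tDK j k⁆ = 0 := by
  rw [← proj_of, ← proj_of, ← proj_of, ← map_add, ← LieHom.map_lie]
  exact proj_eq_zero.2 (LieSubmodule.subset_lieSpan
    (Or.inr (Or.inr (Or.inl ⟨i, j, k, hij, hik, hjk, rfl⟩))))

theorem lieSpan_t :
    LieSubalgebra.lieSpan ℚ (DK n) (Set.range fun p : Fin n × Fin n => tDK p.1 p.2) = ⊤ := by
  refine eq_top_iff.2 fun u _ => ?_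
  obtain ⟨u, rfl⟩ := proj_surjective u
  induction u using FreeLieAlgebra.induction with
  | of x => exact LieSubalgebra.subset_lieSpan ⟨x, rfl⟩
  | zero => simp
  | add u v hu hv => rw [map_add]; exact add_mem (hu trivial) (hv trivial)
  | smul a u hu => rw [map_smul]; exact LieSubalgebra.smul_mem _ a (hu trivial)
  | lie u v hu hv => rw [LieHom.map_lie]; exact LieSubalgebra.lie_mem _ (hu trivial) (hv trivial)

/-- The central element `t₁₂ + t₁₃ + t₂₃` of `𝔤₃`. -/
def casimir : DK 3 := tDK 0 1 + tDK 0 2 + tDK 1 2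

theorem lie_casimir (u : DK 3) : ⁅u, casimir⁆ = 0 := by
  have h₀ := lie_add_t (n := 3) (i := 0) (j := 1) (k := 2) (by decide) (by decide) (by decide)
  have h₁ := lie_add_t (n := 3) (i := 1) (j := 0) (k := 2) (by decide) (by decide) (by decide)
  have h₂ := lie_add_t (n := 3) (i := 2) (j := 0) (k := 1) (by decide) (by decide) (by decide)
  rw [t_symm 1 0] at h₁
  rw [t_symm 2 0, t_symm 2 1] at h₂
  have e₀ : ⁅(tDK 0 1 : DK 3), casimir⁆ = 0 := by
    rw [← lie_skew, neg_eq_zero, ← h₂, casimir, add_assoc, add_lie, lie_self, zero_add]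
  have e₁ : ⁅(tDK 0 2 : DK 3), casimir⁆ = 0 := by
    rw [← lie_skew, neg_eq_zero, ← h₁, casimir, add_right_comm, add_lie, lie_self, add_zero]
  have e₂ : ⁅(tDK 1 2 : DK 3), casimir⁆ = 0 := by
    rw [← lie_skew, neg_eq_zero, ← h₀, casimir, add_lie, lie_self, add_zero]
  have hu : u ∈ LieSubalgebra.lieSpan ℚ (DK 3)
      (Set.range fun p : Fin 3 × Fin 3 => tDK p.1 p.2) := by simp [lieSpan_t]
  induction hu using LieSubalgebra.lieSpan_induction with
  | mem _ h =>
    obtain ⟨⟨i, j⟩, rfl⟩ := h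
    fin_cases i <;> fin_cases j <;>
      simp [t_self, e₀, e₁, e₂, t_symm 1 0, t_symm 2 0, t_symm 2 1]
  | zero => simp
  | add u v _ _ hu hv => rw [add_lie, hu, hv, add_zero]
  | smul a u _ hu => rw [smul_lie, hu, smul_zero]
  | lie u v _ _ hu hv => rw [lie_lie, hu, hv, lie_zero, lie_zero, sub_zero]

/-- A Lie algebra map out of `𝔤₃` is determined by the images of `t₁₂`, `t₁₃`, `t₂₃`, which may be
arbitrary subject to their sum commuting with each of them. -/
theorem exists_lieHom_three (a b c : L) (ha : ⁅a + b + c, a⁆ = 0) (hb : ⁅a + b + c, b⁆ = 0)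
    (hc : ⁅a + b + c, c⁆ = 0) :
    ∃ F : DK 3 →ₗ⁅ℚ⁆ L, F (tDK 0 1) = a ∧ F (tDK 0 2) = b ∧ F (tDK 1 2) = c := by
  let M : Matrix (Fin 3) (Fin 3) L := !![0, a, b; a, 0, c; b, c, 0]
  obtain ⟨F, hF⟩ := exists_lieHom (L := L) (fun p : Fin 3 × Fin 3 => M p.1 p.2) (by
    simp only [add_lie, lie_self, add_zero, zero_add] at ha hb hc
    have ha' : ⁅c, a⁆ + ⁅b, a⁆ = 0 := by rw [add_comm, ha]
    have hb' : ⁅c, b⁆ + ⁅a, b⁆ = 0 := by rw [add_comm, hb]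
    have hc' : ⁅b, c⁆ + ⁅a, c⁆ = 0 := by rw [add_comm, hc]
    rintro r (⟨i, rfl⟩ | ⟨i, j, rfl⟩ | ⟨i, j, k, hij, hik, hjk, rfl⟩ |
      ⟨i, j, k, l, h, hij, hkl, rfl⟩)
    · fin_cases i <;> simp [M]
    · fin_cases i <;> fin_cases j <;> simp [M]
    · fin_cases i <;> fin_cases j <;> fin_cases k <;> simp_all [M]
    · have hmem (x : Fin 3) : ¬ ((x = i ∨ x = j) ∧ (x = k ∨ x = l)) := fun hx =>
        (h ▸ (show x ∈ ({i, j} ∩ {k, l} : Set (Fin 3)) from hx) : x ∈ (∅ : Set (Fin 3)))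
      have := hmem i; have := hmem j
      omega)
  exact ⟨F, hF 0 1, hF 0 2, hF 1 2⟩

/-- The inclusion of the free Lie algebra on `t₁₃`, `t₂₃` into `𝔤₃`. -/
def freeIncl : FreeLieAlgebra ℚ (Fin 2) →ₗ⁅ℚ⁆ DK 3 := lift ℚ ![tDK 0 2, tDK 1 2]

theorem exists_retraction : ∃ F : DK 3 →ₗ⁅ℚ⁆ FreeLieAlgebra ℚ (Fin 2),
    ∀ w, F (freeIncl w) = w := by
  obtain ⟨F, -, h₁, h₂⟩ := exists_lieHom_three
    (-(of ℚ (0 : Fin 2) + of ℚ 1)) (of ℚ 0) (of ℚ 1)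
    (by simp [add_assoc]) (by simp [add_assoc]) (by simp [add_assoc])
  have h : F.comp freeIncl = LieHom.id := by
    ext x
    fin_cases x <;> simp [freeIncl, h₁, h₂]
  exact ⟨F, fun w => congr($h w)⟩

theorem freeIncl_injective : Function.Injective freeIncl := by
  obtain ⟨F, hF⟩ := exists_retraction
  exact Function.LeftInverse.injective hF

theorem exists_coefficient : ∃ q : DK 3 →ₗ[ℚ] ℚ,
    q (tDK 0 1) = 1 ∧ ∀ w, q (freeIncl w) = 0 := by
  let _ : LieRing ℚ := LieRing.ofAssociativeRing
  let _ : LieAlgebra ℚ ℚ := LieAlgebra.ofAssociativeAlgebra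
  obtain ⟨q, h₀, h₁, h₂⟩ := exists_lieHom_three (1 : ℚ) 0 0
    (by simp) (by simp) (by simp)
  refine ⟨q, h₀, fun w => ?_⟩
  have h : q.comp freeIncl = 0 := by
    ext x
    fin_cases x <;> simp [freeIncl, h₁, h₂]
  exact congr($h w)

theorem range_freeIncl :
    freeIncl.range = LieSubalgebra.lieSpan ℚ (DK 3) {tDK 0 2, tDK 1 2} := by
  rw [LieHom.range_eq_map, ← lieSpan_range_of, LieSubalgebra.map_lieSpan, ← Set.range_comp]
  congr 1
  ext u
  simp [freeIncl, or_comm]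

theorem exists_eq_add_casimir (u : DK 3) : ∃ w, ∃ a : ℚ, u = freeIncl w + a • casimir := by
  have h₁ : freeIncl (of ℚ 0) = tDK 0 2 := by simp [freeIncl]
  have h₂ : freeIncl (of ℚ 1) = tDK 1 2 := by simp [freeIncl]
  have e₀ : ∃ w, ∃ a : ℚ, (tDK 0 1 : DK 3) = freeIncl w + a • casimir :=
    ⟨-(of ℚ 0 + of ℚ 1), 1, by
      rw [map_neg, map_add, h₁, h₂, one_smul, casimir]; abel⟩
  have e₁ : ∃ w, ∃ a : ℚ, (tDK 0 2 : DK 3) = freeIncl w + a • casimir := ⟨of ℚ 0, 0, by simp [h₁]⟩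
  have e₂ : ∃ w, ∃ a : ℚ, (tDK 1 2 : DK 3) = freeIncl w + a • casimir := ⟨of ℚ 1, 0, by simp [h₂]⟩
  have e : ∃ w, ∃ a : ℚ, (0 : DK 3) = freeIncl w + a • casimir := ⟨0, 0, by simp⟩
  have hu : u ∈ LieSubalgebra.lieSpan ℚ (DK 3)
      (Set.range fun p : Fin 3 × Fin 3 => tDK p.1 p.2) := by simp [lieSpan_t]
  induction hu using LieSubalgebra.lieSpan_induction with
  | mem _ h =>
    obtain ⟨⟨i, j⟩, rfl⟩ := h
    fin_cases i <;> fin_cases j <;>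
      simpa only [Fin.zero_eta, Fin.mk_one, Fin.reduceFinMk, t_self, t_symm 1 0, t_symm 2 0,
        t_symm 2 1]
  | zero => exact e
  | add u v _ _ hu hv =>
    obtain ⟨w, a, rfl⟩ := hu
    obtain ⟨w', a', rfl⟩ := hv
    exact ⟨w + w', a + a', by rw [map_add, add_smul]; abel⟩
  | smul b u _ hu =>
    obtain ⟨w, a, rfl⟩ := hu
    exact ⟨b • w, b * a, by rw [map_smul, smul_add, smul_smul]⟩
  | lie u v _ _ hu hv =>
    obtain ⟨w, a, rfl⟩ := hu
    obtain ⟨w', a', rfl⟩ := hv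
    refine ⟨⁅w, w'⁆, 0, ?_⟩
    rw [lie_add, lie_smul, lie_casimir, add_lie, smul_lie, ← lie_skew casimir, lie_casimir,
      LieHom.map_lie]
    simp

end DK

/-- (indices: `t 0 1 = t_{12}`, `t 0 2 = t_{13}`, `t 1 2 = t_{23}`.)
The Drinfeld–Kohno Lie algebra `𝔤₃` decomposes as a vector space as the direct
sum of the Lie subalgebra `𝔦₃` generated by `t_{13}, t_{23}` — which is free on
these two generators and is an ideal — and the line spanned by `t_{12}`;
moreover the center of `𝔤₃` is spanned by `t_{12} + t_{13} + t_{23}`. -/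
theorem dk3_structure :
    letI i3 : LieSubalgebra ℚ (DK 3) :=
      LieSubalgebra.lieSpan ℚ (DK 3) {tDK 0 2, tDK 1 2}
    -- vector space direct sum decomposition 𝔤₃ = 𝔦₃ ⊕ ℚ·t₁₂
    (i3.toSubmodule ⊓ Submodule.span ℚ {tDK 0 1} = ⊥) ∧
    (i3.toSubmodule ⊔ Submodule.span ℚ {tDK 0 1} = ⊤) ∧
    -- 𝔦₃ is free on the two generators t₁₃, t₂₃
    (∃ e : FreeLieAlgebra ℚ (Fin 2) ≃ₗ⁅ℚ⁆ i3,
        ((e (FreeLieAlgebra.of ℚ 0) : i3) : DK 3) = tDK 0 2 ∧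
        ((e (FreeLieAlgebra.of ℚ 1) : i3) : DK 3) = tDK 1 2) ∧
    -- 𝔦₃ is an ideal
    (∀ x y : DK 3, y ∈ i3 → ⁅x, y⁆ ∈ i3) ∧
    -- the center is spanned by t₁₂ + t₁₃ + t₂₃
    (∀ x : DK 3, x ∈ LieAlgebra.center ℚ (DK 3) ↔
        x ∈ Submodule.span ℚ {tDK 0 1 + tDK 0 2 + tDK 1 2}) := by
  open DK in
  rw [← range_freeIncl]
  refine ⟨?_, ?_, ?_, ?_, fun x => ⟨fun hx => ?_, fun hx => ?_⟩⟩
  · obtain ⟨q, hq, hq'⟩ := exists_coefficient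
    refine eq_bot_iff.2 ?_
    rintro _ ⟨⟨w, rfl⟩, hw⟩
    obtain ⟨a, ha⟩ := Submodule.mem_span_singleton.1 hw
    have h := congr(q $ha)
    have ha0 : a = 0 := by simpa [hq] using h.trans (hq' w)
    rw [Submodule.mem_bot, ← ha, ha0, zero_smul]
  · refine eq_top_iff.2 fun u _ => ?_
    obtain ⟨w, a, rfl⟩ := exists_eq_add_casimir u
    have h : freeIncl w + a • casimir =
        freeIncl (w + a • (of ℚ 0 + of ℚ 1)) + a • tDK 0 1 := by
      simp only [casimir, freeIncl, map_add, map_smul, lift_of_apply, Matrix.cons_val_zero,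
        Matrix.cons_val_one, smul_add]
      abel
    rw [h]
    exact Submodule.add_mem_sup ⟨_, rfl⟩
      (Submodule.smul_mem _ a (Submodule.mem_span_singleton_self _))
  · exact ⟨LieEquiv.ofInjective freeIncl freeIncl_injective,
      (LieEquiv.ofInjective_apply _ _ _).trans (by simp [freeIncl]),
      (LieEquiv.ofInjective_apply _ _ _).trans (by simp [freeIncl])⟩
  · rintro x _ ⟨v, rfl⟩
    obtain ⟨w, a, rfl⟩ := exists_eq_add_casimir x
    refine ⟨⁅w, v⁆, ?_⟩
    rw [add_lie, smul_lie, ← lie_skew casimir, lie_casimir, neg_zero, smul_zero, add_zero]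
    exact LieHom.map_lie _ _ _
  · obtain ⟨w, a, rfl⟩ := exists_eq_add_casimir x
    have hw : w = 0 := eq_zero_of_forall_lie_eq_zero fun v => freeIncl_injective <| by
      have h : ⁅freeIncl v, freeIncl w + a • casimir⁆ = 0 := hx _
      rwa [lie_add, lie_smul, lie_casimir, smul_zero, add_zero, ← LieHom.map_lie,
        ← map_zero freeIncl] at h
    rw [hw, map_zero, zero_add]
    exact Submodule.smul_mem _ a (Submodule.mem_span_singleton_self _)
  · obtain ⟨a, rfl⟩ := Submodule.mem_span_singleton.1 hx
    intro u
    rw [lie_smul]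
    exact (congrArg (a • ·) (lie_casimir u)).trans (smul_zero a)
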